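/- Let H be a finite simple star-cutset-free connected graph, let J = (V1,V2,X1,X2,Y1,Y2) be a 2-join of H, and let H1 and H2 be parity-preserving blocks of decomposition for J. Define h(H) = |V(H)| + |{v ∈ V(H) : deg_H(v) ≥ 3}|, and similarly for H1 and H2. Then at least one of the following holds: (a) for some {i,j} = {1,2}, one of the vertex sets X_i∪V_j, Y_i∪V_j, or X_i∪Y_i∪V_j induces a 6-hole of H; (b) both h(H1)+h(H2) ≤ h(H)+14 and max{h(H1),h(H2)} ≤ h(H)−1. -/

import Mathlib

namespace TwoJoin

variable {V : Type*}

/-- A vertex set inducing a path graph (a tree of maximum degree at most two). -/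
def IsPathSet (G : SimpleGraph V) (P : Set V) : Prop :=
  (G.induce P).IsTree ∧
    ∀ v ∈ P, ∀ a ∈ P, ∀ b ∈ P, ∀ c ∈ P,
      G.Adj v a → G.Adj v b → G.Adj v c → a = b ∨ a = c ∨ b = c

/-- `v` is an end-vertex of the path with vertex set `P`. -/
def IsEndOf (G : SimpleGraph V) (P : Set V) (v : V) : Prop :=
  v ∈ P ∧ ∀ a ∈ P, ∀ b ∈ P, G.Adj v a → G.Adj v b → a = b

/-- A `UW`-path: either a single vertex in `U ∩ W`, or an (induced) path with
one end-vertex in `U` and the other in `W`. -/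
def IsUWPath (G : SimpleGraph V) (U W P : Set V) : Prop :=
  (∃ x, x ∈ U ∧ x ∈ W ∧ P = {x}) ∨
  (IsPathSet G P ∧ ∃ u w, u ≠ w ∧ u ∈ U ∧ w ∈ W ∧ IsEndOf G P u ∧ IsEndOf G P w)

/-- A `UW`-rung of `G[A]`: a vertex-minimal induced `UW`-path inside `A`. -/
def IsRungIn (G : SimpleGraph V) (A U W P : Set V) : Prop :=
  P ⊆ A ∧ IsUWPath G U W P ∧ ∀ Q, Q ⊆ A → IsUWPath G U W Q → P.ncard ≤ Q.ncard

/-- `C` is a hole of `H`. -/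
def IsHole (H : SimpleGraph V) (C : Set V) : Prop :=
  (H.induce C).Connected ∧ (∀ v ∈ C, {w ∈ C | H.Adj v w}.ncard = 2) ∧ 4 ≤ C.ncard

/-- The vertex set `S` induces a 6-hole of `H`. -/
def Is6Hole (H : SimpleGraph V) (S : Set V) : Prop := IsHole H S ∧ S.ncard = 6

/-- `H` has a star-cutset: a set `S ⊆ N[s]` for some `s ∈ S` whose removal
increases the number of connected components. -/
def HasStarCutset (H : SimpleGraph V) : Prop :=
  ∃ S : Set V, (∃ s ∈ S, ∀ x ∈ S, x = s ∨ H.Adj s x) ∧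
    Nat.card ((H.induce Sᶜ).ConnectedComponent) > Nat.card (H.ConnectedComponent)

/-- `(V1, V2, X1, X2, Y1, Y2)` is a 2-join of `H`. -/
def Is2Join (H : SimpleGraph V) (V1 V2 X1 X2 Y1 Y2 : Set V) : Prop :=
  V1 ∪ V2 = Set.univ ∧ V1 ∩ V2 = ∅ ∧ 3 ≤ V1.ncard ∧ 3 ≤ V2.ncard ∧
  X1 ⊆ V1 ∧ Y1 ⊆ V1 ∧ X1 ∩ Y1 = ∅ ∧ X1.Nonempty ∧ Y1.Nonempty ∧
  X2 ⊆ V2 ∧ Y2 ⊆ V2 ∧ X2 ∩ Y2 = ∅ ∧ X2.Nonempty ∧ Y2.Nonempty ∧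
  ¬ IsRungIn H V1 X1 Y1 V1 ∧ ¬ IsRungIn H V2 X2 Y2 V2 ∧
  ∀ v1 ∈ V1, ∀ v2 ∈ V2,
    (H.Adj v1 v2 ↔ (v1 ∈ X1 ∧ v2 ∈ X2) ∨ (v1 ∈ Y1 ∧ v2 ∈ Y2))

/-- The parity-preserving block of decomposition on side `Vi`: the graph
`H[Vi]` together with a new path on `p` vertices with end-vertices `xj = 0` and
`yj = p - 1`, all edges between `Xi` and `xj`, and all edges between `Yi` and
`yj`. -/
def blockGraph (H : SimpleGraph V) (Vi Xi Yi : Set V) (p : ℕ) :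
    SimpleGraph (↥Vi ⊕ Fin p) :=
  SimpleGraph.fromRel (fun a b =>
    match a, b with
    | Sum.inl x, Sum.inl y => H.Adj x.1 y.1
    | Sum.inl x, Sum.inr k => (x.1 ∈ Xi ∧ k.1 = 0) ∨ (x.1 ∈ Yi ∧ k.1 = p - 1)
    | Sum.inr _, Sum.inl _ => False
    | Sum.inr k, Sum.inr l => l.1 = k.1 + 1)

/-- `h(K) = |V(K)| + #{v : deg v ≥ 3}`. -/
noncomputable def hval {α : Type*} (K : SimpleGraph α) : ℕ :=
  Nat.card α + Nat.card {v : α | 3 ≤ (K.neighborSet v).ncard}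

section Helpers

set_option linter.unusedSectionVars false

theorem sc_gen {V : Type*} [Fintype V] {H : SimpleGraph V} (hconn : H.Connected)
    (hsc : ¬ HasStarCutset H) (s : V) (S C : Set V) (c w : V) (hc : c ∈ C) (hs : s ∈ S)
    (hst : ∀ x ∈ S, x = s ∨ H.Adj s x) (hSC : ∀ x ∈ S, x ∉ C)
    (hN : ∀ c ∈ C, ∀ d, H.Adj c d → d ∈ C ∨ d ∈ S)
    (hw : w ∉ C) (hwS : w ∈ Sᶜ) : False := by
  apply hsc
  refine ⟨S, ⟨s, hs, hst⟩, ?_⟩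
  have h1 : Nat.card H.ConnectedComponent = 1 := by
    have := hconn.preconnected.subsingleton_connectedComponent
    have : Nonempty H.ConnectedComponent := ⟨H.connectedComponentMk c⟩
    exact Nat.card_unique
  rw [h1]
  have hcS : c ∈ Sᶜ := fun h => hSC _ h hc
  have key : ∀ (a b : ↥Sᶜ), (H.induce Sᶜ).Walk a b → a.1 ∈ C → b.1 ∈ C := by
    intro a b p
    induction p with
    | nil => exact id
    | @cons a d b hadj p ih =>
      intro ha
      apply ih
      have hadj' : H.Adj a.1 d.1 := hadj
      by_contra hd
      rcases hN _ ha _ hadj' with h | h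
      · exact hd h
      · exact d.2 h
  have : Nontrivial (H.induce Sᶜ).ConnectedComponent := by
    refine ⟨(H.induce Sᶜ).connectedComponentMk ⟨c, hcS⟩,
      (H.induce Sᶜ).connectedComponentMk ⟨w, hwS⟩, ?_⟩
    intro h
    rw [SimpleGraph.ConnectedComponent.eq] at h
    obtain ⟨p⟩ := h
    exact hw (key _ _ p hc)
  exact Finite.one_lt_card

theorem sc_aux {V : Type*} [Fintype V] {H : SimpleGraph V} (hconn : H.Connected)
    (hsc : ¬ HasStarCutset H) (s : V) (C : Set V) (c w : V) (hc : c ∈ C) (hs : s ∉ C)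
    (hN : ∀ c ∈ C, ∀ d, H.Adj c d → d ∈ C ∨ d = s ∨ H.Adj s d)
    (hw : w ∉ C) (hws : w ≠ s) (hsw : ¬ H.Adj s w) : False := by
  refine sc_gen hconn hsc s {t | (t = s ∨ H.Adj s t) ∧ t ∉ C} C c w hc ⟨Or.inl rfl, hs⟩
    (fun x hx => hx.1) (fun x hx => hx.2) ?_ hw ?_
  · intro c hc d hcd
    by_cases hd : d ∈ C
    · exact Or.inl hd
    · right
      rcases hN c hc d hcd with h | h
      · exact (hd h).elim
      · exact ⟨h, hd⟩
  · rintro ⟨h | h, _⟩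
    · exact hws h
    · exact hsw h

structure Cfg {V : Type*} (H : SimpleGraph V) (A B X Y X' Y' : Set V) : Prop where
  conn : H.Connected
  hsc : ¬ HasStarCutset H
  cov : ∀ v, v ∈ A ∨ v ∈ B
  dis : ∀ v, v ∈ A → v ∈ B → False
  hA : 3 ≤ A.ncard
  hB : 3 ≤ B.ncard
  hX : X ⊆ A
  hY : Y ⊆ A
  hXY : ∀ v, v ∈ X → v ∈ Y → False
  nX : X.Nonempty
  nY : Y.Nonempty
  hX' : X' ⊆ B
  hY' : Y' ⊆ B
  hXY' : ∀ v, v ∈ X' → v ∈ Y' → False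
  nX' : X'.Nonempty
  nY' : Y'.Nonempty
  adj : ∀ v1 ∈ A, ∀ v2 ∈ B, (H.Adj v1 v2 ↔ (v1 ∈ X ∧ v2 ∈ X') ∨ (v1 ∈ Y ∧ v2 ∈ Y'))

variable {V : Type*} [Fintype V] {H : SimpleGraph V} {A B X Y X' Y' : Set V}

theorem Cfg.swapXY (J : Cfg H A B X Y X' Y') : Cfg H A B Y X Y' X' :=
  ⟨J.conn, J.hsc, J.cov, J.dis, J.hA, J.hB, J.hY, J.hX, fun v h1 h2 => J.hXY v h2 h1, J.nY, J.nX,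
    J.hY', J.hX', fun v h1 h2 => J.hXY' v h2 h1, J.nY', J.nX',
    fun v1 h1 v2 h2 => (J.adj v1 h1 v2 h2).trans or_comm⟩

theorem Cfg.L (J : Cfg H A B X Y X' Y') (s : V) (C : Set V) (c : V) (hsB : s ∈ B) (hC : C ⊆ B)
    (hc : c ∈ C) (hs : s ∉ C)
    (hN : ∀ c ∈ C, ∀ d ∈ B, H.Adj c d → d ∈ C ∨ d = s ∨ H.Adj s d)
    (h1 : ∀ c ∈ C, c ∈ X' → s ∈ X') (h2 : ∀ c ∈ C, c ∈ Y' → s ∈ Y') : False := by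
  have hN' : ∀ c ∈ C, ∀ d, H.Adj c d → d ∈ C ∨ d = s ∨ H.Adj s d := by
    intro c hc d hcd
    rcases J.cov d with hd | hd
    · right; right
      have := (J.adj d hd c (hC hc)).1 hcd.symm
      refine ((J.adj d hd s hsB).2 ?_).symm
      rcases this with h | h
      · exact Or.inl ⟨h.1, h1 c hc h.2⟩
      · exact Or.inr ⟨h.1, h2 c hc h.2⟩
    · exact hN c hc d hd hcd
  have fin : ∀ w ∈ A, ¬ H.Adj s w → False := fun w hw hn =>
    sc_aux J.conn J.hsc s C c w hc hs hN' (fun h => J.dis w hw (hC h))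
      (fun h => J.dis w hw (h ▸ hsB)) hn
  by_cases hsX : s ∈ X'
  · obtain ⟨w, hw⟩ := J.nY
    refine fin w (J.hY hw) fun h => ?_
    rcases (J.adj w (J.hY hw) s hsB).1 h.symm with h | h
    · exact J.hXY _ h.1 hw
    · exact J.hXY' _ hsX h.2
  · obtain ⟨w, hw⟩ := J.nX
    refine fin w (J.hX hw) fun h => ?_
    rcases (J.adj w (J.hX hw) s hsB).1 h.symm with h | h
    · exact hsX h.2
    · exact J.hXY _ hw h.1

theorem Cfg.nbr (J : Cfg H A B X Y X' Y') (x : V) (hx : x ∈ X') : ∃ d ∈ B, H.Adj x d := by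
  by_contra hno
  push Not at hno
  by_cases h : ∃ x' ∈ X', x' ≠ x
  · obtain ⟨x', hx', hne⟩ := h
    refine J.L x' {x} x (J.hX' hx') (by simpa using J.hX' hx) rfl (by simpa using hne) ?_ ?_ ?_
    · rintro c rfl d hd hcd
      exact (hno d hd hcd).elim
    · rintro c rfl _; exact hx'
    · rintro c rfl h; exact (J.hXY' _ hx h).elim
  · push Not at h
    obtain ⟨y, hy⟩ := J.nY'
    have hyx : y ≠ x := fun e => J.hXY' _ hx (e ▸ hy)
    obtain ⟨c, hcB, hcn⟩ : ∃ c ∈ B, c ∉ ({x, y} : Set V) := by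
      by_contra hh
      push Not at hh
      have : B.ncard ≤ ({x, y} : Set V).ncard := Set.ncard_le_ncard hh
      have h2 := Set.ncard_pair hyx.symm
      have := J.hB
      omega
    refine J.L y (B \ {x, y}) c (J.hY' hy) Set.sdiff_subset ⟨hcB, hcn⟩ (by simp) ?_ ?_ ?_
    · rintro c ⟨hc, hc'⟩ d hd hcd
      by_cases hdy : d = y
      · exact Or.inr (Or.inl hdy)
      · by_cases hdx : d = x
        · subst hdx
          exact (hno c hc hcd.symm).elim
        · left; exact ⟨hd, by simp [hdx, hdy]⟩
    · rintro c ⟨hc, hc'⟩ h'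
      have := h c h'
      simp [this] at hc'
    · intro _ _ _; exact hy

theorem three_deg (v a b c : V) (h1 : H.Adj v a) (h2 : H.Adj v b) (h3 : H.Adj v c)
    (hab : a ≠ b) (hac : a ≠ c) (hbc : b ≠ c) : 3 ≤ (H.neighborSet v).ncard := by
  have : ({a, b, c} : Set V).ncard = 3 := Set.ncard_eq_three.2 ⟨a, b, c, hab, hac, hbc, rfl⟩
  rw [← this]
  refine Set.ncard_le_ncard ?_ (Set.toFinite _)
  rintro t (rfl | rfl | rfl) <;> assumption

theorem Cfg.degX (J : Cfg H A B X Y X' Y') (h2 : 2 ≤ X.ncard) (x : V) (hx : x ∈ X') :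
    3 ≤ (H.neighborSet x).ncard := by
  obtain ⟨a, b, ha, hb, hab⟩ := (Set.one_lt_ncard_iff).1 h2
  obtain ⟨d, hd, hxd⟩ := J.nbr x hx
  refine three_deg x a b d ?_ ?_ hxd hab ?_ ?_
  · exact ((J.adj a (J.hX ha) x (J.hX' hx)).2 (Or.inl ⟨ha, hx⟩)).symm
  · exact ((J.adj b (J.hX hb) x (J.hX' hx)).2 (Or.inl ⟨hb, hx⟩)).symm
  · rintro rfl; exact J.dis _ (J.hX ha) hd
  · rintro rfl; exact J.dis _ (J.hX hb) hd

theorem hex (c0 c1 c2 c3 c4 c5 : V) (h01 : H.Adj c0 c1) (h12 : H.Adj c1 c2) (h23 : H.Adj c2 c3)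
    (h34 : H.Adj c3 c4) (h45 : H.Adj c4 c5) (h50 : H.Adj c5 c0)
    (n02 : ¬ H.Adj c0 c2) (n03 : ¬ H.Adj c0 c3) (n04 : ¬ H.Adj c0 c4)
    (n13 : ¬ H.Adj c1 c3) (n14 : ¬ H.Adj c1 c4) (n15 : ¬ H.Adj c1 c5)
    (n24 : ¬ H.Adj c2 c4) (n25 : ¬ H.Adj c2 c5) (n35 : ¬ H.Adj c3 c5)
    (S : Set V) (hS : S = {c0, c1, c2, c3, c4, c5}) : Is6Hole H S := by
  have d01 := h01.ne
  have d12 := h12.ne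
  have d23 := h23.ne
  have d34 := h34.ne
  have d45 := h45.ne
  have d50 := h50.ne
  have d02 : c0 ≠ c2 := by rintro rfl; exact n03 h23
  have d03 : c0 ≠ c3 := by rintro rfl; exact n02 h23.symm
  have d04 : c0 ≠ c4 := by rintro rfl; exact n03 h34.symm
  have d13 : c1 ≠ c3 := by rintro rfl; exact n14 h34
  have d14 : c1 ≠ c4 := by rintro rfl; exact n13 h34.symm
  have d15 : c1 ≠ c5 := by rintro rfl; exact n14 h45.symm
  have d24 : c2 ≠ c4 := by rintro rfl; exact n25 h45
  have d25 : c2 ≠ c5 := by rintro rfl; exact n24 h45.symm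
  have d35 : c3 ≠ c5 := by rintro rfl; exact n03 h50.symm
  have card : S.ncard = 6 := by
    classical
    have : S = (↑({c0, c1, c2, c3, c4, c5} : Finset V) : Set V) := by rw [hS]; simp
    rw [this, Set.ncard_coe_finset]
    repeat rw [Finset.card_insert_of_notMem (by simp; grind)]
    simp
  have m0 : c0 ∈ S := by simp [hS]
  have m1 : c1 ∈ S := by simp [hS]
  have m2 : c2 ∈ S := by simp [hS]
  have m3 : c3 ∈ S := by simp [hS]
  have m4 : c4 ∈ S := by simp [hS]
  have m5 : c5 ∈ S := by simp [hS]
  refine ⟨⟨?_, ?_, by omega⟩, card⟩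
  · rw [SimpleGraph.connected_iff_exists_forall_reachable]
    have e01 : (H.induce S).Reachable ⟨c0, m0⟩ ⟨c1, m1⟩ := SimpleGraph.Adj.reachable h01
    have e12 : (H.induce S).Reachable ⟨c1, m1⟩ ⟨c2, m2⟩ := SimpleGraph.Adj.reachable h12
    have e23 : (H.induce S).Reachable ⟨c2, m2⟩ ⟨c3, m3⟩ := SimpleGraph.Adj.reachable h23
    have e34 : (H.induce S).Reachable ⟨c3, m3⟩ ⟨c4, m4⟩ := SimpleGraph.Adj.reachable h34
    have e45 : (H.induce S).Reachable ⟨c4, m4⟩ ⟨c5, m5⟩ := SimpleGraph.Adj.reachable h45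
    refine ⟨⟨c0, m0⟩, ?_⟩
    rintro ⟨t, ht⟩
    have ht' := ht
    rw [hS] at ht'
    rcases ht' with rfl | rfl | rfl | rfl | rfl | rfl
    · rfl
    · exact e01
    · exact e01.trans e12
    · exact (e01.trans e12).trans e23
    · exact ((e01.trans e12).trans e23).trans e34
    · exact (((e01.trans e12).trans e23).trans e34).trans e45
  · have aux : ∀ v a b : V, a ≠ b → a ∈ S → b ∈ S → H.Adj v a → H.Adj v b →
        (∀ t ∈ S, H.Adj v t → t = a ∨ t = b) → {w ∈ S | H.Adj v w}.ncard = 2 := by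
      intro v a b hab ha hb hva hvb hall
      rw [← Set.ncard_pair hab]
      congr 1
      ext t
      constructor
      · rintro ⟨h1, h2⟩; exact hall t h1 h2
      · rintro (rfl | rfl)
        · exact ⟨ha, hva⟩
        · exact ⟨hb, hvb⟩
    have mem : ∀ t ∈ S, t = c0 ∨ t = c1 ∨ t = c2 ∨ t = c3 ∨ t = c4 ∨ t = c5 := by
      intro t ht; rw [hS] at ht; simpa using ht
    have sy : ∀ a b, H.Adj a b → H.Adj b a := fun a b h => h.symm
    have irr : ∀ a, ¬ H.Adj a a := fun a => H.irrefl
    intro v hv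
    rcases mem v hv with rfl | rfl | rfl | rfl | rfl | rfl
    · exact aux _ c1 c5 d15 m1 m5 h01 h50.symm (by intro t ht hvt; rcases mem t ht with rfl | rfl | rfl | rfl | rfl | rfl <;> grind)
    · exact aux _ c0 c2 d02 m0 m2 h01.symm h12 (by intro t ht hvt; rcases mem t ht with rfl | rfl | rfl | rfl | rfl | rfl <;> grind)
    · exact aux _ c1 c3 d13 m1 m3 h12.symm h23 (by intro t ht hvt; rcases mem t ht with rfl | rfl | rfl | rfl | rfl | rfl <;> grind)
    · exact aux _ c2 c4 d24 m2 m4 h23.symm h34 (by intro t ht hvt; rcases mem t ht with rfl | rfl | rfl | rfl | rfl | rfl <;> grind)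
    · exact aux _ c3 c5 d35 m3 m5 h34.symm h45 (by intro t ht hvt; rcases mem t ht with rfl | rfl | rfl | rfl | rfl | rfl <;> grind)
    · exact aux _ c4 c0 d04.symm m4 m0 h45.symm h50 (by intro t ht hvt; rcases mem t ht with rfl | rfl | rfl | rfl | rfl | rfl <;> grind)

/-- rung facts -/
theorem path_nbr {P : Set V} (hP : IsPathSet H P) (h2 : 2 ≤ P.ncard) (v : V) (hv : v ∈ P) :
    ∃ d ∈ P, H.Adj v d := by
  have hc := hP.1.connected
  obtain ⟨a, b, ha, hb, hab⟩ := (Set.one_lt_ncard_iff).1 h2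
  have : Nontrivial ↥P := ⟨⟨a, ha⟩, ⟨b, hb⟩, by simpa using hab⟩
  obtain ⟨⟨d, hd⟩, h⟩ := hc.preconnected.exists_adj_of_nontrivial ⟨v, hv⟩
  exact ⟨d, hd, h⟩

theorem edge_path (x y : V) (hxy : H.Adj x y) (U W : Set V) (hx : x ∈ U) (hy : y ∈ W) :
    IsUWPath H U W {x, y} := by
  right
  refine ⟨⟨⟨?_, ?_⟩, ?_⟩, x, y, hxy.ne, hx, hy, ⟨by simp, ?_⟩, ⟨by simp, ?_⟩⟩
  · rw [SimpleGraph.connected_iff_exists_forall_reachable]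
    refine ⟨⟨x, by simp⟩, ?_⟩
    rintro ⟨t, ht⟩
    have ht' := ht
    rcases ht' with rfl | rfl
    · rfl
    · exact SimpleGraph.Adj.reachable (by exact hxy)
  · intro v c hc
    have h3 := hc.three_le_length
    have hn := hc.support_nodup
    classical
    have := hn.length_le_card
    have h4 : Fintype.card ↥({x, y} : Set V) = 2 := by
      rw [← Nat.card_eq_fintype_card, Nat.card_coe_set_eq, Set.ncard_pair hxy.ne]
    simp at this
    rw [Fintype.card_congr (Equiv.refl _)] at h4
    simp at h4
    omega
  · rintro v (rfl | rfl) a (rfl | rfl) b (rfl | rfl) c (rfl | rfl) <;> simp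
  · rintro a (rfl | rfl) b (rfl | rfl) <;> simp
  · rintro a (rfl | rfl) b (rfl | rfl) <;> simp

theorem rung_two_le {P : Set V} (J : Cfg H A B X Y X' Y') (hP : IsRungIn H B X' Y' P) :
    2 ≤ P.ncard ∧ ∃ x ∈ X', ∃ y ∈ Y', x ≠ y ∧ IsPathSet H P ∧ IsEndOf H P x ∧ IsEndOf H P y := by
  rcases hP.2.1 with ⟨x, h1, h2, _⟩ | ⟨h1, u, w, huw, hu, hw, eu, ew⟩
  · exact (J.hXY' _ h1 h2).elim
  · refine ⟨?_, u, hu, w, hw, huw, h1, eu, ew⟩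
    exact (Set.one_lt_ncard_iff).2 ⟨u, w, eu.1, ew.1, huw⟩

theorem rung_two {P : Set V} (J : Cfg H A B X Y X' Y') (hP : IsRungIn H B X' Y' P)
    (h : P.ncard = 2) : ∃ x ∈ X', ∃ y ∈ Y', H.Adj x y := by
  obtain ⟨h2, x, hx, y, hy, hne, hp, ex, ey⟩ := rung_two_le J hP
  refine ⟨x, hx, y, hy, ?_⟩
  obtain ⟨d, hd, hxd⟩ := path_nbr hp h2 x ex.1
  have : ({x, y} : Set V) = P := by
    refine Set.eq_of_subset_of_ncard_le ?_ ?_ (Set.toFinite _)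
    · rintro t (rfl | rfl); exacts [ex.1, ey.1]
    · rw [h, Set.ncard_pair hne]
  rw [← this] at hd
  rcases hd with rfl | rfl
  · exact (H.irrefl hxd).elim
  · exact hxd

theorem rung_three {P : Set V} (J : Cfg H A B X Y X' Y') (hP : IsRungIn H B X' Y' P)
    (h : P.ncard = 3) : (∀ x ∈ X', ∀ y ∈ Y', ¬ H.Adj x y) ∧
      ∃ x ∈ X', ∃ y ∈ Y', ∃ q ∈ B, H.Adj x q ∧ H.Adj q y := by
  have hno : ∀ x ∈ X', ∀ y ∈ Y', ¬ H.Adj x y := by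
    intro x hx y hy hxy
    have h1 := hP.2.2 {x, y} (by rintro t (rfl | rfl); exacts [J.hX' hx, J.hY' hy])
      (edge_path x y hxy _ _ hx hy)
    rw [Set.ncard_pair hxy.ne] at h1
    omega
  refine ⟨hno, ?_⟩
  obtain ⟨h2, x, hx, y, hy, hne, hp, ex, ey⟩ := rung_two_le J hP
  obtain ⟨d, hd, hxd⟩ := path_nbr hp h2 x ex.1
  obtain ⟨e, he, hye⟩ := path_nbr hp h2 y ey.1
  refine ⟨x, hx, y, hy, d, hP.1 hd, hxd, ?_⟩
  have hdy : d ≠ y := by rintro rfl; exact hno x hx d hy hxd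
  have : ({x, y, d} : Set V) = P := by
    refine Set.eq_of_subset_of_ncard_le ?_ ?_ (Set.toFinite _)
    · rintro t (rfl | rfl | rfl); exacts [ex.1, ey.1, hd]
    · rw [h, Set.ncard_eq_three.2 ⟨x, y, d, hne, hxd.ne, hdy.symm, rfl⟩]
  rw [← this] at he
  rcases he with rfl | rfl | rfl
  · exact (hno e hx y hy hye.symm).elim
  · exact (H.irrefl hye).elim
  · exact hye.symm


def D (H : SimpleGraph V) (B : Set V) : Set V := {v ∈ B | 3 ≤ (H.neighborSet v).ncard}

theorem case_A4 (J : Cfg H A B X Y X' Y') (x y z w : V) (hx : x ∈ X') (hy : y ∈ Y')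
    (hxy : H.Adj x y) (hz : z ∈ X') (hw : w ∈ Y') (hzx : z ≠ x) (hwy : w ≠ y)
    (hB : ∀ v ∈ B, v = x ∨ v = y ∨ v = z ∨ v = w)
    (hD : (D H B).ncard ≤ (if 2 ≤ X.ncard then 1 else 0) + (if 2 ≤ Y.ncard then 1 else 0)) :
    Is6Hole H (X ∪ Y ∪ B) := by
  have hxB := J.hX' hx
  have hzB := J.hX' hz
  have hyB := J.hY' hy
  have hwB := J.hY' hw
  have nxy := hxy.ne
  have nzy : z ≠ y := fun e => J.hXY' _ hz (e ▸ hy)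
  have nzw : z ≠ w := fun e => J.hXY' _ hz (e ▸ hw)
  have nxw : x ≠ w := fun e => J.hXY' _ hx (e ▸ hw)
  have pX : 2 ≤ X.ncard → ({x, z} : Set V) ⊆ D H B := by
    rintro h t (rfl | rfl)
    · exact ⟨hxB, J.degX h _ hx⟩
    · exact ⟨hzB, J.degX h _ hz⟩
  have pY : 2 ≤ Y.ncard → ({y, w} : Set V) ⊆ D H B := by
    rintro h t (rfl | rfl)
    · exact ⟨hyB, J.swapXY.degX h _ hy⟩
    · exact ⟨hwB, J.swapXY.degX h _ hw⟩
  have c1 : ({x, z} : Set V).ncard = 2 := Set.ncard_pair hzx.symm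
  have c2 : ({y, w} : Set V).ncard = 2 := Set.ncard_pair hwy.symm
  have c3 : ({x, z} ∪ {y, w} : Set V).ncard = 4 := by
    rw [Set.ncard_union_eq, c1, c2]
    rw [Set.disjoint_left]
    rintro t (rfl | rfl) (h | h) <;> simp_all
  have aX : ¬ 2 ≤ X.ncard := by
    intro h
    by_cases h' : 2 ≤ Y.ncard
    · have := Set.ncard_le_ncard (Set.union_subset (pX h) (pY h'))
      simp only [h, h', if_true] at hD
      omega
    · have := Set.ncard_le_ncard (pX h)
      simp only [h, h', if_true, if_false] at hD
      omega
  have aY : ¬ 2 ≤ Y.ncard := by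
    intro h
    have := Set.ncard_le_ncard (pY h)
    simp only [h, aX, if_true, if_false] at hD
    omega
  simp only [aX, aY, if_false] at hD
  have hD0 : D H B = ∅ := (Set.ncard_eq_zero).1 (by omega)
  have small : ∀ v ∈ B, ¬ 3 ≤ (H.neighborSet v).ncard := by
    intro v hv h
    have : v ∈ D H B := ⟨hv, h⟩
    rw [hD0] at this
    exact this
  have cX : X.ncard = 1 := by
    have := (Set.ncard_pos).2 J.nX
    omega
  have cY : Y.ncard = 1 := by
    have := (Set.ncard_pos).2 J.nY
    omega
  obtain ⟨u, rfl⟩ := Set.ncard_eq_one.1 cX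
  obtain ⟨v, rfl⟩ := Set.ncard_eq_one.1 cY
  have huA : u ∈ A := J.hX rfl
  have hvA : v ∈ A := J.hY rfl
  have huv : u ≠ v := fun e => J.hXY u rfl e
  have aux : H.Adj u x := (J.adj _ huA _ hxB).2 (Or.inl ⟨rfl, hx⟩)
  have auz : H.Adj u z := (J.adj _ huA _ hzB).2 (Or.inl ⟨rfl, hz⟩)
  have avy : H.Adj v y := (J.adj _ hvA _ hyB).2 (Or.inr ⟨rfl, hy⟩)
  have avw : H.Adj v w := (J.adj _ hvA _ hwB).2 (Or.inr ⟨rfl, hw⟩)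
  have nB : ∀ t ∈ B, u ≠ t ∧ v ≠ t := fun t ht =>
    ⟨fun e => J.dis _ huA (e ▸ ht), fun e => J.dis _ hvA (e ▸ ht)⟩
  have nxz : ¬ H.Adj x z := fun h => small x hxB (three_deg x u y z aux.symm hxy h
    (nB y hyB).1 (nB z hzB).1 nzy.symm)
  have nxw' : ¬ H.Adj x w := fun h => small x hxB (three_deg x u y w aux.symm hxy h
    (nB y hyB).1 (nB w hwB).1 hwy.symm)
  have nyz' : ¬ H.Adj y z := fun h => small y hyB (three_deg y v x z avy.symm hxy.symm h
    (nB x hxB).2 (nB z hzB).2 hzx.symm)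
  have nyw' : ¬ H.Adj y w := fun h => small y hyB (three_deg y v x w avy.symm hxy.symm h
    (nB x hxB).2 (nB w hwB).2 nxw)
  have azw : H.Adj z w := by
    obtain ⟨d, hd, h⟩ := J.nbr z hz
    rcases hB d hd with rfl | rfl | rfl | rfl
    · exact (nxz h.symm).elim
    · exact (nyz' h.symm).elim
    · exact (H.irrefl h).elim
    · exact h
  have nuv : ¬ H.Adj u v := by
    intro h
    obtain ⟨c, hcA, hcn⟩ : ∃ c ∈ A, c ∉ ({u, v} : Set V) := by
      by_contra hh
      push Not at hh
      have : A.ncard ≤ ({u, v} : Set V).ncard := Set.ncard_le_ncard hh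
      have h2 := Set.ncard_pair huv
      have := J.hA
      omega
    simp only [Set.mem_insert_iff, Set.mem_singleton_iff, not_or] at hcn
    refine sc_gen J.conn J.hsc u {u, v} B x c hxB (by simp) ?_ ?_ ?_ (J.dis c hcA) ?_
    · rintro t (rfl | rfl)
      · exact Or.inl rfl
      · exact Or.inr h
    · rintro t (rfl | rfl) ht
      · exact (nB _ ht).1 rfl
      · exact (nB _ ht).2 rfl
    · intro b hb d hbd
      rcases J.cov d with hd | hd
      · right
        rcases (J.adj d hd b hb).1 hbd.symm with h | h
        · exact Or.inl h.1
        · exact Or.inr h.1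
      · exact Or.inl hd
    · rintro (h | h)
      · exact hcn.1 h
      · exact hcn.2 h
  have nuy : ¬ H.Adj u y := fun h => by
    rcases (J.adj _ huA _ hyB).1 h with h | h
    · exact J.hXY' _ h.2 hy
    · exact huv h.1
  have nuw : ¬ H.Adj u w := fun h => by
    rcases (J.adj _ huA _ hwB).1 h with h | h
    · exact J.hXY' _ h.2 hw
    · exact huv h.1
  have nvx : ¬ H.Adj v x := fun h => by
    rcases (J.adj _ hvA _ hxB).1 h with h | h
    · exact huv h.1.symm
    · exact J.hXY' _ hx h.2
  have nvz : ¬ H.Adj v z := fun h => by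
    rcases (J.adj _ hvA _ hzB).1 h with h | h
    · exact huv h.1.symm
    · exact J.hXY' _ hz h.2
  refine hex u x y v w z aux hxy avy.symm avw azw.symm auz.symm nuy nuv nuw
    (fun h => nvx h.symm) nxw' nxz nyw' nyz' nvz _ ?_
  ext t
  simp only [Set.mem_union, Set.mem_singleton_iff, Set.mem_insert_iff]
  constructor
  · rintro ((rfl | rfl) | h)
    · simp
    · simp
    · rcases hB t h with rfl | rfl | rfl | rfl <;> simp
  · rintro (rfl | rfl | rfl | rfl | rfl | rfl) <;> simp [*]

theorem case_B5 (J : Cfg H A B X Y X' Y') (x q y z w : V) (hx : x ∈ X') (hy : y ∈ Y')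
    (hq : q ∈ B) (hxq : H.Adj x q) (hqy : H.Adj q y) (hno : ∀ x ∈ X', ∀ y ∈ Y', ¬ H.Adj x y)
    (hz : z ∈ X') (hw : w ∈ B) (hzx : z ≠ x) (hwx : w ≠ x) (hwy : w ≠ y) (hwq : w ≠ q)
    (hwz : w ≠ z)
    (hB : ∀ v ∈ B, v = x ∨ v = q ∨ v = y ∨ v = z ∨ v = w)
    (hD : (D H B).ncard ≤ (if 2 ≤ X.ncard then 1 else 0) + (if 2 ≤ Y.ncard then 1 else 0)) :
    Is6Hole H (X ∪ B) := by
  have hxB := J.hX' hx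
  have hzB := J.hX' hz
  have hyB := J.hY' hy
  have hqX : q ∉ X' := fun h => hno _ h _ hy hqy
  have hqY : q ∉ Y' := fun h => hno _ hx _ h hxq
  have nxy : x ≠ y := fun e => J.hXY' _ hx (e ▸ hy)
  have nzy : z ≠ y := fun e => J.hXY' _ hz (e ▸ hy)
  have nzq : z ≠ q := fun e => hqX (e ▸ hz)
  have nzy' := hno z hz y hy
  have nxy' := hno x hx y hy
  -- if w is not in Y' and not adjacent to y, contradiction
  have key : w ∉ Y' → H.Adj w y := by
    intro hwY
    by_contra hwy'
    refine J.L x {z, w} z hxB ?_ (by simp) ?_ ?_ ?_ ?_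
    · rintro t (rfl | rfl) <;> assumption
    · rintro (h | h)
      · exact hzx h.symm
      · exact hwx h.symm
    · intro c hc d hd hcd
      rcases hB d hd with rfl | rfl | rfl | rfl | rfl
      · exact Or.inr (Or.inl rfl)
      · exact Or.inr (Or.inr hxq)
      · rcases hc with rfl | rfl
        · exact (nzy' hcd).elim
        · exact (hwy' hcd).elim
      · simp
      · simp
    · intro _ _ _; exact hx
    · rintro c (rfl | rfl) h
      · exact (J.hXY' _ hz h).elim
      · exact (hwY h).elim
  have pX : 2 ≤ X.ncard → ({x, z} : Set V) ⊆ D H B := by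
    rintro h t (rfl | rfl)
    · exact ⟨hxB, J.degX h _ hx⟩
    · exact ⟨hzB, J.degX h _ hz⟩
  have c1 : ({x, z} : Set V).ncard = 2 := Set.ncard_pair hzx.symm
  have c2 : ({x, z} ∪ {y} : Set V).ncard = 3 := by
    rw [Set.ncard_union_eq, c1, Set.ncard_singleton]
    rw [Set.disjoint_left]
    rintro t (rfl | rfl) h <;> simp_all
  have aX : ¬ 2 ≤ X.ncard := by
    intro h
    by_cases h' : 2 ≤ Y.ncard
    · have hyD : ({y} : Set V) ⊆ D H B := by
        rintro t rfl
        exact ⟨hyB, J.swapXY.degX h' _ hy⟩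
      have := Set.ncard_le_ncard (Set.union_subset (pX h) hyD)
      simp only [h, h', if_true] at hD
      omega
    · have := Set.ncard_le_ncard (pX h)
      simp only [h, h', if_true, if_false] at hD
      omega
  have cX : X.ncard = 1 := by
    have := (Set.ncard_pos).2 J.nX
    omega
  simp only [aX, if_false] at hD
  obtain ⟨u, rfl⟩ := Set.ncard_eq_one.1 cX
  have huA : u ∈ A := J.hX rfl
  have aux : H.Adj u x := (J.adj _ huA _ hxB).2 (Or.inl ⟨rfl, hx⟩)
  have auz : H.Adj u z := (J.adj _ huA _ hzB).2 (Or.inl ⟨rfl, hz⟩)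
  have nB : ∀ t ∈ B, u ≠ t := fun t ht e => J.dis _ huA (e ▸ ht)
  obtain ⟨v, hv⟩ := J.nY
  have hvA : v ∈ A := J.hY hv
  have nBv : ∀ t ∈ B, v ≠ t := fun t ht e => J.dis _ hvA (e ▸ ht)
  have avy : H.Adj v y := (J.adj _ hvA _ hyB).2 (Or.inr ⟨hv, hy⟩)
  have nuX : ∀ t ∈ B, t ∉ X' → ¬ H.Adj u t := fun t ht htX h => by
    rcases (J.adj _ huA _ ht).1 h with h | h
    · exact htX h.2
    · exact J.hXY u rfl h.1
  -- the only possible vertex of large degree is y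
  have small : ∀ t ∈ B, t ≠ y → ¬ 3 ≤ (H.neighborSet t).ncard := by
    intro t ht hty h3
    have htD : t ∈ D H B := ⟨ht, h3⟩
    have hyD : y ∈ D H B → False := by
      intro hyD
      have : 2 ≤ (D H B).ncard := (Set.one_lt_ncard_iff).2 ⟨t, y, htD, hyD, hty⟩
      split_ifs at hD <;> omega
    by_cases h' : 2 ≤ Y.ncard
    · exact hyD ⟨hyB, J.swapXY.degX h' _ hy⟩
    · simp only [h', if_false] at hD
      have : D H B = ∅ := (Set.ncard_eq_zero).1 (by omega)
      rw [this] at htD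
      exact htD
  have nxz : ¬ H.Adj x z := fun h => small x hxB nxy (three_deg x u q z aux.symm hxq h
    (nB q hq) (nB z hzB) nzq.symm)
  have nxw : ¬ H.Adj x w := fun h => small x hxB nxy (three_deg x u q w aux.symm hxq h
    (nB q hq) (nB w hw) hwq.symm)
  have nqz : ¬ H.Adj q z := fun h => small q hq hqy.ne (three_deg q x y z hxq.symm hqy h
    nxy hzx.symm nzy.symm)
  have nqw : ¬ H.Adj q w := fun h => small q hq hqy.ne (three_deg q x y w hxq.symm hqy h
    nxy hwx.symm hwy.symm)
  have azw : H.Adj z w := by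
    obtain ⟨d, hd, h⟩ := J.nbr z hz
    rcases hB d hd with rfl | rfl | rfl | rfl | rfl
    · exact (nxz h.symm).elim
    · exact (nqz h.symm).elim
    · exact (nzy' h).elim
    · exact (H.irrefl h).elim
    · exact h
  have hwY : w ∉ Y' := fun h => hno z hz w h azw
  have awy := key hwY
  have hwX : w ∉ X' := fun h => hno w h y hy awy
  have hyX : y ∉ X' := fun h => J.hXY' _ h hy
  refine hex u x q y w z aux hxq hqy awy.symm azw.symm auz.symm (nuX q hq hqX) (nuX y hyB hyX)
    (nuX w hw hwX) nxy' nxw nxz nqw nqz (fun h => nzy' h.symm) _ ?_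
  ext t
  simp only [Set.mem_union, Set.mem_singleton_iff, Set.mem_insert_iff]
  constructor
  · rintro (rfl | h)
    · simp
    · rcases hB t h with rfl | rfl | rfl | rfl | rfl <;> simp
  · rintro (rfl | rfl | rfl | rfl | rfl | rfl) <;> simp [*]

theorem half (J : Cfg H A B X Y X' Y') (P : Set V) (p : ℕ) (hP : IsRungIn H B X' Y' P)
    (hBr : ¬ IsRungIn H B X' Y' B)
    (hp : (Even P.ncard ∧ p = 4) ∨ (¬ Even P.ncard ∧ p = 5)) :
    (Is6Hole H (X ∪ B) ∨ Is6Hole H (Y ∪ B) ∨ Is6Hole H (X ∪ Y ∪ B)) ∨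
    p + (if 2 ≤ X.ncard then 1 else 0) + (if 2 ≤ Y.ncard then 1 else 0) + 1
      ≤ B.ncard + (D H B).ncard := by
  by_contra hcon
  rw [not_or] at hcon
  obtain ⟨h6, hlt⟩ := hcon
  have hPB : P.ncard < B.ncard := by
    by_contra h
    have : P = B := Set.eq_of_subset_of_ncard_le hP.1 (by omega) (Set.toFinite _)
    exact hBr (this ▸ hP)
  have hr2 := (rung_two_le J hP).1
  have hBp : B.ncard ≤ p := by
    have e1 : (if 2 ≤ X.ncard then 1 else 0) + (if 2 ≤ Y.ncard then 1 else 0) ≤ (D H B).ncard := by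
      obtain ⟨x, hx⟩ := J.nX'
      obtain ⟨y, hy⟩ := J.nY'
      have nxy : x ≠ y := fun e => J.hXY' _ hx (e ▸ hy)
      have f1 : 2 ≤ X.ncard → x ∈ D H B := fun h => ⟨J.hX' hx, J.degX h x hx⟩
      have f2 : 2 ≤ Y.ncard → y ∈ D H B := fun h => ⟨J.hY' hy, J.swapXY.degX h y hy⟩
      split_ifs with h1 h2 h2
      · exact (Set.one_lt_ncard_iff).2 ⟨x, y, f1 h1, f2 h2, nxy⟩
      · exact (Set.ncard_pos).2 ⟨x, f1 h1⟩
      · exact (Set.ncard_pos).2 ⟨y, f2 h2⟩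
      · omega
    omega
  have hB3 := J.hB
  rcases hp with ⟨hev, rfl⟩ | ⟨hodd, rfl⟩
  · have hr : P.ncard = 2 := by
      rcases hev with ⟨k, hk⟩; omega
    obtain ⟨x, hx, y, hy, hxy⟩ := rung_two J hP hr
    have hxB := J.hX' hx
    have hyB := J.hY' hy
    have hsub : ({x, y} : Set V) ⊆ B := by rintro t (rfl | rfl) <;> assumption
    -- any set of remaining vertices missing Y' or X' is impossible
    have kx : ∀ c ∈ B, c ≠ x → c ≠ y → (∀ d ∈ B, d ≠ x → d ≠ y → d ∉ Y') → False := by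
      intro c hc hcx hcy hall
      refine J.L x (B \ {x, y}) c hxB Set.sdiff_subset ⟨hc, by simp [hcx, hcy]⟩ (by simp) ?_ ?_ ?_
      · rintro c ⟨hc, hc'⟩ d hd hcd
        by_cases hdx : d = x
        · exact Or.inr (Or.inl hdx)
        · by_cases hdy : d = y
          · subst hdy; exact Or.inr (Or.inr hxy)
          · left; exact ⟨hd, by simp [hdx, hdy]⟩
      · intro _ _ _; exact hx
      · rintro c ⟨hc, hc'⟩ h
        simp only [Set.mem_insert_iff, Set.mem_singleton_iff, not_or] at hc'
        exact (hall c hc hc'.1 hc'.2 h).elim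
    have ky : ∀ c ∈ B, c ≠ x → c ≠ y → (∀ d ∈ B, d ≠ x → d ≠ y → d ∉ X') → False := by
      intro c hc hcx hcy hall
      refine J.L y (B \ {x, y}) c hyB Set.sdiff_subset ⟨hc, by simp [hcx, hcy]⟩ (by simp) ?_ ?_ ?_
      · rintro c ⟨hc, hc'⟩ d hd hcd
        by_cases hdy : d = y
        · exact Or.inr (Or.inl hdy)
        · by_cases hdx : d = x
          · subst hdx; exact Or.inr (Or.inr hxy.symm)
          · left; exact ⟨hd, by simp [hdx, hdy]⟩
      · rintro c ⟨hc, hc'⟩ h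
        simp only [Set.mem_insert_iff, Set.mem_singleton_iff, not_or] at hc'
        exact (hall c hc hc'.1 hc'.2 h).elim
      · intro _ _ _; exact hy
    obtain ⟨c, hcB, hcn⟩ : ∃ c ∈ B, c ∉ ({x, y} : Set V) := by
      by_contra hh
      push Not at hh
      have : B.ncard ≤ ({x, y} : Set V).ncard := Set.ncard_le_ncard hh
      have h2 := Set.ncard_pair hxy.ne
      omega
    simp only [Set.mem_insert_iff, Set.mem_singleton_iff, not_or] at hcn
    obtain ⟨w, hwB, hwx, hwy, hw⟩ : ∃ d ∈ B, d ≠ x ∧ d ≠ y ∧ d ∈ Y' := by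
      by_contra h; push Not at h; exact kx c hcB hcn.1 hcn.2 h
    obtain ⟨z, hzB, hzx, hzy, hz⟩ : ∃ d ∈ B, d ≠ x ∧ d ≠ y ∧ d ∈ X' := by
      by_contra h; push Not at h; exact ky c hcB hcn.1 hcn.2 h
    have hzw : z ≠ w := fun e => J.hXY' _ hz (e ▸ hw)
    have c4 : ({x, y, z, w} : Set V).ncard = 4 := by
      classical
      have : ({x, y, z, w} : Set V) = (↑({x, y, z, w} : Finset V) : Set V) := by simp
      rw [this, Set.ncard_coe_finset]
      have := hxy.ne
      repeat rw [Finset.card_insert_of_notMem (by simp; grind)]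
      simp
    have hBe : ({x, y, z, w} : Set V) = B := by
      refine Set.eq_of_subset_of_ncard_le ?_ (by omega) (Set.toFinite _)
      rintro t (rfl | rfl | rfl | rfl) <;> assumption
    have hc4 : B.ncard = 4 := by rw [← hBe, c4]
    refine h6 (Or.inr (Or.inr (case_A4 J x y z w hx hy hxy hz hw hzx hwy ?_ (by omega))))
    intro v hv; rw [← hBe] at hv; simpa using hv
  · have hr : P.ncard = 3 := by
      have h4 : P.ncard ≠ 4 := fun h => hodd (by rw [h]; decide)
      have h2 : P.ncard ≠ 2 := fun h => hodd (by rw [h]; decide)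
      omega
    obtain ⟨hno, x, hx, y, hy, q, hq, hxq, hqy⟩ := rung_three J hP hr
    have hxB := J.hX' hx
    have hyB := J.hY' hy
    have hxy : x ≠ y := fun e => J.hXY' _ hx (e ▸ hy)
    -- no set of remaining vertices avoids X' and Y'
    obtain ⟨c, hcB, hcn⟩ : ∃ c ∈ B, c ∉ ({x, q, y} : Set V) := by
      by_contra hh
      push Not at hh
      have : B.ncard ≤ ({x, q, y} : Set V).ncard := Set.ncard_le_ncard hh
      have h2 : ({x, q, y} : Set V).ncard = 3 :=
        Set.ncard_eq_three.2 ⟨x, q, y, hxq.ne, hxy, hqy.ne, rfl⟩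
      omega
    obtain ⟨z, hzB, hzn, hz⟩ : ∃ d ∈ B, d ∉ ({x, q, y} : Set V) ∧ (d ∈ X' ∨ d ∈ Y') := by
      by_contra h
      push Not at h
      refine J.L q (B \ {x, q, y}) c hq Set.sdiff_subset ⟨hcB, hcn⟩ (by simp) ?_ ?_ ?_
      · rintro c ⟨hc, hc'⟩ d hd hcd
        by_cases hdn : d ∈ ({x, q, y} : Set V)
        · rcases hdn with rfl | rfl | rfl
          · exact Or.inr (Or.inr hxq.symm)
          · exact Or.inr (Or.inl rfl)
          · exact Or.inr (Or.inr hqy)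
        · exact Or.inl ⟨hd, hdn⟩
      · rintro c ⟨hc, hc'⟩ h'; exact ((h c hc hc').1 h').elim
      · rintro c ⟨hc, hc'⟩ h'; exact ((h c hc hc').2 h').elim
    simp only [Set.mem_insert_iff, Set.mem_singleton_iff, not_or] at hzn
    obtain ⟨hzx, hzq, hzy⟩ := hzn
    -- there is a fifth vertex
    obtain ⟨w, hwB, hwn⟩ : ∃ w ∈ B, w ∉ ({x, q, y, z} : Set V) := by
      by_contra hh
      push Not at hh
      rcases hz with hz | hz
      · refine J.L x {z} z hxB (by simpa using hzB) rfl (by simpa using Ne.symm hzx) ?_ ?_ ?_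
        · rintro c rfl d hd hcd
          rcases hh d hd with rfl | rfl | rfl | rfl
          · exact Or.inr (Or.inl rfl)
          · exact Or.inr (Or.inr hxq)
          · exact (hno _ hz _ hy hcd).elim
          · exact Or.inl rfl
        · intro _ _ _; exact hx
        · rintro c rfl h; exact (J.hXY' _ hz h).elim
      · refine J.L y {z} z hyB (by simpa using hzB) rfl (by simpa using Ne.symm hzy) ?_ ?_ ?_
        · rintro c rfl d hd hcd
          rcases hh d hd with rfl | rfl | rfl | rfl
          · exact (hno _ hx _ hz hcd.symm).elim
          · exact Or.inr (Or.inr hqy.symm)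
          · exact Or.inr (Or.inl rfl)
          · exact Or.inl rfl
        · rintro c rfl h; exact (J.hXY' _ h hz).elim
        · intro _ _ _; exact hy
    simp only [Set.mem_insert_iff, Set.mem_singleton_iff, not_or] at hwn
    obtain ⟨hwx, hwq, hwy, hwz⟩ := hwn
    have c5 : ({x, q, y, z, w} : Set V).ncard = 5 := by
      classical
      have : ({x, q, y, z, w} : Set V) = (↑({x, q, y, z, w} : Finset V) : Set V) := by simp
      rw [this, Set.ncard_coe_finset]
      have := hxq.ne
      have := hqy.ne
      repeat rw [Finset.card_insert_of_notMem (by simp; grind)]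
      simp
    have hBe : ({x, q, y, z, w} : Set V) = B := by
      refine Set.eq_of_subset_of_ncard_le ?_ (by omega) (Set.toFinite _)
      rintro t (rfl | rfl | rfl | rfl | rfl) <;> assumption
    have hc5 : B.ncard = 5 := by rw [← hBe, c5]
    have hall : ∀ v ∈ B, v = x ∨ v = q ∨ v = y ∨ v = z ∨ v = w := by
      intro v hv; rw [← hBe] at hv; simpa using hv
    rcases hz with hz | hz
    · exact h6 (Or.inl (case_B5 J x q y z w hx hy hq hxq hqy hno hz hwB hzx hwx hwy hwq hwz hall
        (by omega)))
    · refine h6 (Or.inr (Or.inl (case_B5 J.swapXY y q x z w hy hx hq hqy.symm hxq.symm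
        (fun a ha b hb h => hno b hb a ha h.symm) hz hwB hzy hwy hwx hwq hwz ?_ (by omega))))
      intro v hv
      have := hall v hv
      tauto

theorem block_inl_inl (H : SimpleGraph V) (A X Y : Set V) (p : ℕ) (v w : A) :
    (blockGraph H A X Y p).Adj (Sum.inl v) (Sum.inl w) ↔ H.Adj v.1 w.1 := by
  simp only [blockGraph, SimpleGraph.fromRel_adj]
  constructor
  · rintro ⟨_, h | h⟩
    · exact h
    · exact h.symm
  · intro h
    exact ⟨fun e => h.ne (by rw [Sum.inl.inj e]), Or.inl h⟩

theorem block_inl_inr (H : SimpleGraph V) (A X Y : Set V) (p : ℕ) (v : A) (k : Fin p) :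
    (blockGraph H A X Y p).Adj (Sum.inl v) (Sum.inr k) ↔
      (v.1 ∈ X ∧ k.1 = 0) ∨ (v.1 ∈ Y ∧ k.1 = p - 1) := by
  simp [blockGraph, SimpleGraph.fromRel_adj]

theorem block_inr_inr (H : SimpleGraph V) (A X Y : Set V) (p : ℕ) (k l : Fin p) :
    (blockGraph H A X Y p).Adj (Sum.inr k) (Sum.inr l) ↔ (l.1 = k.1 + 1 ∨ k.1 = l.1 + 1) := by
  simp only [blockGraph, SimpleGraph.fromRel_adj]
  constructor
  · rintro ⟨_, h⟩
    exact h
  · intro h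
    refine ⟨fun e => ?_, h⟩
    rw [Sum.inr.inj e] at h
    omega

theorem deg_inl (J : Cfg H A B X Y X' Y') (p : ℕ) (hp : 2 ≤ p) (v : A) :
    ((blockGraph H A X Y p).neighborSet (Sum.inl v)).ncard ≤ (H.neighborSet v.1).ncard := by
  obtain ⟨x, hx⟩ := J.nX'
  obtain ⟨y, hy⟩ := J.nY'
  have hxB := J.hX' hx
  have hyB := J.hY' hy
  have hxy : x ≠ y := fun e => J.hXY' _ hx (e ▸ hy)
  let f : A ⊕ Fin p → V := fun t => match t with
    | Sum.inl w => w.1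
    | Sum.inr k => if k.1 = 0 then x else y
  refine Set.ncard_le_ncard_of_injOn f ?_ ?_ (Set.toFinite _)
  · rintro (w | k) h
    · exact (block_inl_inl H A X Y p v w).1 h
    · have h' := (block_inl_inr H A X Y p v k).1 h
      rw [SimpleGraph.mem_neighborSet, J.adj v.1 v.2 _ (by simp only [f]; split_ifs <;> assumption)]
      rcases h' with h' | h'
      · left; simp only [f, h'.2, if_true]; exact ⟨h'.1, hx⟩
      · right
        have : k.1 ≠ 0 := by omega
        simp only [f, this, if_false]; exact ⟨h'.1, hy⟩
  · rintro (w | k) h (w' | k') h' e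
    · congr 1; exact Subtype.ext e
    · exfalso
      have e : w.1 = if k'.1 = 0 then x else y := e
      have := w.2
      refine J.dis _ w.2 ?_
      rw [e]; split_ifs <;> assumption
    · exfalso
      have e : (if k.1 = 0 then x else y) = w'.1 := e
      refine J.dis _ w'.2 ?_
      rw [← e]; split_ifs <;> assumption
    · have h1 := (block_inl_inr H A X Y p v k).1 h
      have h2 := (block_inl_inr H A X Y p v k').1 h'
      congr 1
      apply Fin.ext
      rcases h1 with h1 | h1 <;> rcases h2 with h2 | h2
      · omega
      · exact (J.hXY _ h1.1 h2.1).elim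
      · exact (J.hXY _ h2.1 h1.1).elim
      · omega

theorem hval_block (J : Cfg H A B X Y X' Y') (p : ℕ) (hp : 2 ≤ p) :
    hval (blockGraph H A X Y p) ≤ A.ncard + p + (D H A).ncard +
      (if 2 ≤ X.ncard then 1 else 0) + (if 2 ≤ Y.ncard then 1 else 0) := by
  classical
  have hcard : Nat.card (↥A ⊕ Fin p) = A.ncard + p := by
    rw [Nat.card_sum, Nat.card_coe_set_eq, Nat.card_fin]
  unfold hval
  rw [hcard, Nat.card_coe_set_eq]
  have h0 : 0 < p := by omega
  have h1 : p - 1 < p := by omega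
  let S1 : Set (↥A ⊕ Fin p) := Sum.inl '' {v : A | 3 ≤ (H.neighborSet v.1).ncard}
  let S2 : Set (↥A ⊕ Fin p) := if 2 ≤ X.ncard then {Sum.inr ⟨0, h0⟩} else ∅
  let S3 : Set (↥A ⊕ Fin p) := if 2 ≤ Y.ncard then {Sum.inr ⟨p - 1, h1⟩} else ∅
  have hsub : {v | 3 ≤ ((blockGraph H A X Y p).neighborSet v).ncard} ⊆ S1 ∪ S2 ∪ S3 := by
    rintro (v | k) h
    · exact Or.inl (Or.inl ⟨v, le_trans h (deg_inl J p hp v), rfl⟩)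
    · have h : 3 ≤ ((blockGraph H A X Y p).neighborSet (Sum.inr k)).ncard := h
      by_contra hn
      have hn2 : ¬ (2 ≤ X.ncard ∧ k.1 = 0) := by
        rintro ⟨a, b⟩
        apply hn
        left; right
        simp only [S2, a, if_true]
        rw [Set.mem_singleton_iff]; congr 1; exact Fin.ext b
      have hn3 : ¬ (2 ≤ Y.ncard ∧ k.1 = p - 1) := by
        rintro ⟨a, b⟩
        apply hn
        right
        simp only [S3, a, if_true]
        rw [Set.mem_singleton_iff]; congr 1; exact Fin.ext b
      -- bound the neighbourhood through an injection into ℕ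
      have sing : ∀ Z : Set V, ¬ 2 ≤ Z.ncard → ∀ a ∈ Z, ∀ b ∈ Z, a = b := by
        intro Z hZ a ha b hb
        by_contra hab
        exact hZ ((Set.one_lt_ncard_iff).2 ⟨a, b, ha, hb, hab⟩)
      let g : A ⊕ Fin p → ℕ := fun t => match t with
        | Sum.inl w => if k.1 = 0 then 0 else k.1 + 2
        | Sum.inr l => l.1 + 1
      have hle : ((blockGraph H A X Y p).neighborSet (Sum.inr k)).ncard ≤
          ({k.1, k.1 + 2} : Set ℕ).ncard := by
        refine Set.ncard_le_ncard_of_injOn g ?_ ?_ (Set.toFinite _)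
        · rintro (w | l) hw
          · simp only [g]; split_ifs with hk
            · simp [hk]
            · simp
          · have := (block_inr_inr H A X Y p k l).1 hw
            simp only [g, Set.mem_insert_iff, Set.mem_singleton_iff]; omega
        · rintro (w | l) hw (w' | l') hw' e
          · have a1 := (block_inl_inr H A X Y p w k).1 hw.symm
            have a2 := (block_inl_inr H A X Y p w' k).1 hw'.symm
            congr 1
            apply Subtype.ext
            rcases a1 with a1 | a1 <;> rcases a2 with a2 | a2
            · exact sing X (fun h => hn2 ⟨h, a1.2⟩) _ a1.1 _ a2.1
            · omega
            · omega
            · exact sing Y (fun h => hn3 ⟨h, a1.2⟩) _ a1.1 _ a2.1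
          · exfalso
            have a1 := (block_inl_inr H A X Y p w k).1 hw.symm
            have a2 := (block_inr_inr H A X Y p k l').1 hw'
            have := l'.2
            simp only [g] at e
            split_ifs at e <;> omega
          · exfalso
            have a1 := (block_inl_inr H A X Y p w' k).1 hw'.symm
            have a2 := (block_inr_inr H A X Y p k l).1 hw
            have := l.2
            simp only [g] at e
            split_ifs at e <;> omega
          · congr 1
            apply Fin.ext
            simp only [g] at e
            omega
      rw [Set.ncard_pair (by omega)] at hle
      omega
  have e1 : S1.ncard = (D H A).ncard := by
    rw [Set.ncard_image_of_injective _ Sum.inl_injective,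
      ← Set.ncard_image_of_injective _ Subtype.val_injective]
    congr 1
    ext t
    simp [D, and_comm]
  have e2 : S2.ncard ≤ if 2 ≤ X.ncard then 1 else 0 := by
    simp only [S2]; split_ifs <;> simp
  have e3 : S3.ncard ≤ if 2 ≤ Y.ncard then 1 else 0 := by
    simp only [S3]; split_ifs <;> simp
  have := Set.ncard_le_ncard hsub
  have := Set.ncard_union_le (S1 ∪ S2) S3
  have := Set.ncard_union_le S1 S2
  omega

theorem hval_H (J : Cfg H A B X Y X' Y') :
    hval H = A.ncard + B.ncard + (D H A).ncard + (D H B).ncard := by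
  have hd : Disjoint A B := Set.disjoint_left.2 (fun v => J.dis v)
  have h1 : Nat.card V = A.ncard + B.ncard := by
    rw [← Set.ncard_union_eq hd, ← Set.ncard_univ]
    congr 1
    ext v
    simpa using J.cov v
  have h2 : {v | 3 ≤ (H.neighborSet v).ncard}.ncard = (D H A).ncard + (D H B).ncard := by
    rw [← Set.ncard_union_eq (hd.mono (fun v h => h.1) (fun v h => h.1))]
    congr 1
    ext v
    have := J.cov v
    simp only [D, Set.mem_union, Set.mem_setOf_eq]
    tauto
  unfold hval
  rw [Nat.card_coe_set_eq, h1, h2]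
  omega

end Helpers

/-- For a star-cutset-free connected graph `H` with a 2-join
`J = (V1,V2,X1,X2,Y1,Y2)` and parity-preserving blocks of decomposition `H1`,
`H2` for `J`: either some of the sets `Xi ∪ Vj`, `Yi ∪ Vj`, `Xi ∪ Yi ∪ Vj`
(for `{i,j} = {1,2}`) induces a 6-hole of `H`, or
`h(H1) + h(H2) ≤ h(H) + 14` and `max{h(H1), h(H2)} ≤ h(H) − 1`. -/
theorem two_join_block_potential
    {V : Type*} [Fintype V] (H : SimpleGraph V)
    (hconn : H.Connected) (hsc : ¬ HasStarCutset H)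
    (V1 V2 X1 X2 Y1 Y2 : Set V) (hJ : Is2Join H V1 V2 X1 X2 Y1 Y2)
    (p1 p2 : ℕ)
    (hp1 : ∃ P, IsRungIn H V1 X1 Y1 P ∧
      ((Even P.ncard ∧ p1 = 4) ∨ (¬ Even P.ncard ∧ p1 = 5)))
    (hp2 : ∃ P, IsRungIn H V2 X2 Y2 P ∧
      ((Even P.ncard ∧ p2 = 4) ∨ (¬ Even P.ncard ∧ p2 = 5))) :
    (Is6Hole H (X1 ∪ V2) ∨ Is6Hole H (Y1 ∪ V2) ∨ Is6Hole H (X1 ∪ Y1 ∪ V2) ∨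
     Is6Hole H (X2 ∪ V1) ∨ Is6Hole H (Y2 ∪ V1) ∨ Is6Hole H (X2 ∪ Y2 ∪ V1)) ∨
    (hval (blockGraph H V1 X1 Y1 p2) + hval (blockGraph H V2 X2 Y2 p1)
        ≤ hval H + 14 ∧
     hval (blockGraph H V1 X1 Y1 p2) ≤ hval H - 1 ∧
     hval (blockGraph H V2 X2 Y2 p1) ≤ hval H - 1) := by
  obtain ⟨q1, q2, q3, q4, q5, q6, q7, q8, q9, q10, q11, q12, q13, q14, q15, q16, q17⟩ := hJ
  have cov : ∀ v, v ∈ V1 ∨ v ∈ V2 := fun v => by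
    have : v ∈ V1 ∪ V2 := by rw [q1]; trivial
    exact this
  have emp : ∀ S T : Set V, S ∩ T = ∅ → ∀ v, v ∈ S → v ∈ T → False := fun S T h v a b => by
    have : v ∈ S ∩ T := ⟨a, b⟩
    rw [h] at this; exact this
  have J1 : Cfg H V1 V2 X1 Y1 X2 Y2 := ⟨hconn, hsc, cov, emp _ _ q2, q3, q4, q5, q6, emp _ _ q7,
    q8, q9, q10, q11, emp _ _ q12, q13, q14, q17⟩
  have J2 : Cfg H V2 V1 X2 Y2 X1 Y1 := ⟨hconn, hsc, fun v => (cov v).symm,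
    fun v a b => emp _ _ q2 v b a, q4, q3, q10, q11, emp _ _ q12, q13, q14, q5, q6, emp _ _ q7,
    q8, q9, fun v2 h2 v1 h1 => by rw [H.adj_comm, q17 v1 h1 v2 h2]; tauto⟩
  obtain ⟨P1, hP1, hp1⟩ := hp1
  obtain ⟨P2, hP2, hp2⟩ := hp2
  have b1 : 4 ≤ p1 ∧ p1 ≤ 5 := by omega
  have b2 : 4 ≤ p2 ∧ p2 ≤ 5 := by omega
  rcases half J1 P2 p2 hP2 q16 hp2 with h | h1
  · left; tauto
  rcases half J2 P1 p1 hP1 q15 hp1 with h | h2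
  · left; tauto
  right
  have e := hval_H J1
  have f1 := hval_block J1 p2 (by omega)
  have f2 := hval_block J2 p1 (by omega)
  split_ifs at * <;> refine ⟨?_, ?_, ?_⟩ <;> omega

end TwoJoin
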